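/- arXiv:2411.10276 — 4 statements merged into one kernel-verified Lean document; each statement's English description precedes it below -/
import Mathlib

section
/- For a finite poset P, the set of extreme points (vertices) of the order polytope O_P is exactly the set of indicator vectors 1_F of filters F of P. That is, a point p of O_P is an extreme point of O_P if and only if there exists a filter F ⊆ P such that p(x) = 1 for x ∈ F and p(x) = 0 for x ∉ F. -/
/-- The order polytope of a poset `P`: functions `p : P → ℝ` with `0 ≤ p x ≤ 1`
and `p x ≤ p y` whenever `x ≤ y`. -/
def orderPolytope (P : Type*) [PartialOrder P] : Set (P → ℝ) :=
  {p | (∀ x, 0 ≤ p x ∧ p x ≤ 1) ∧ ∀ x y : P, x ≤ y → p x ≤ p y}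

theorem sq_mem_orderPolytope {P : Type*} [PartialOrder P] {p : P → ℝ}
    (hp : p ∈ orderPolytope P) : (fun x => p x ^ 2) ∈ orderPolytope P := by
  refine ⟨fun x => ⟨sq_nonneg _, pow_le_one₀ (hp.1 x).1 (hp.1 x).2⟩, fun x y hxy => ?_⟩
  exact pow_le_pow_left₀ (hp.1 x).1 (hp.2 x y hxy) 2

theorem two_mul_sub_sq_mem_orderPolytope {P : Type*} [PartialOrder P] {p : P → ℝ}
    (hp : p ∈ orderPolytope P) : (fun x => 2 * p x - p x ^ 2) ∈ orderPolytope P := by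
  refine ⟨fun x => ?_, fun x y hxy => ?_⟩
  · obtain ⟨h0, h1⟩ := hp.1 x
    constructor <;> nlinarith
  · have hx := (hp.1 x).2
    have hy := (hp.1 y).2
    have h := hp.2 x y hxy
    dsimp only
    nlinarith

/-- The extreme points (vertices) of the order polytope of a finite poset are exactly
the indicator vectors of filters (upward-closed subsets). -/
theorem extremePoints_orderPolytope_iff_filter
    {P : Type*} [PartialOrder P] [Fintype P] (p : P → ℝ) (hp : p ∈ orderPolytope P) :
    p ∈ Set.extremePoints ℝ (orderPolytope P) ↔
      ∃ F : Set P, (∀ x ∈ F, ∀ y, x ≤ y → y ∈ F) ∧ p = Set.indicator F 1 := by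
  constructor
  · intro h
    -- `p` is the midpoint of `p ^ 2` and `2 * p - p ^ 2`.
    have hsq : (fun x => p x ^ 2) = p := by
      refine h.2 (sq_mem_orderPolytope hp) (two_mul_sub_sq_mem_orderPolytope hp)
        ⟨1 / 2, 1 / 2, by norm_num, by norm_num, by norm_num, ?_⟩
      ext x
      simp only [Pi.add_apply, Pi.smul_apply, smul_eq_mul]
      ring
    refine ⟨{x | p x = 1}, fun x hx y hxy => ?_, ?_⟩
    · exact le_antisymm (hp.1 y).2 (hx.symm.le.trans (hp.2 x y hxy))
    · ext x
      by_cases hx : p x = 1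
      · simp [Set.indicator, hx]
      · have h0 : p x * (p x - 1) = 0 := by linear_combination congrFun hsq x
        have hx0 : p x = 0 := (mul_eq_zero.mp h0).resolve_right (sub_ne_zero.mpr hx)
        simp [Set.indicator, hx0]
  · rintro ⟨F, -, rfl⟩
    refine ⟨hp, ?_⟩
    rintro u hu v hv ⟨a, b, ha, hb, hab, huv⟩
    ext x
    have hx := congrFun huv x
    obtain ⟨hu0, hu1⟩ := hu.1 x
    obtain ⟨hv0, hv1⟩ := hv.1 x
    by_cases hxF : x ∈ F
    · simp only [Pi.add_apply, Pi.smul_apply, smul_eq_mul, Set.indicator_of_mem hxF,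
        Pi.one_apply] at hx ⊢
      nlinarith
    · simp only [Pi.add_apply, Pi.smul_apply, smul_eq_mul, Set.indicator_of_notMem hxF] at hx ⊢
      nlinarith
end

section
/- For a finite poset P, the order polytope O_P is equal to the convex hull (over ℝ) of the set of indicator vectors 1_F of filters F of P. -/
open Pointwise in
/-- A nonnegative monotone function bounded by `c` on a finite poset is `c` times a convex
combination of indicator vectors of filters. -/
theorem mem_smul_convexHull_filters {P : Type*} [PartialOrder P] [Fintype P] (p : P → ℝ) (c : ℝ)
    (h0 : ∀ x, 0 ≤ p x) (h1 : ∀ x, p x ≤ c) (hp : ∀ x y : P, x ≤ y → p x ≤ p y) :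
    p ∈ c • convexHull ℝ {q : P → ℝ | ∃ F : Set P,
        (∀ x ∈ F, ∀ y, x ≤ y → y ∈ F) ∧ q = Set.indicator F 1} := by
  classical
  induction hn : (Finset.univ.filter fun x => 0 < p x).card using Nat.strong_induction_on
    generalizing p c with
  | _ n ih =>
  rcases (Finset.univ.filter fun x => 0 < p x).eq_empty_or_nonempty with he | hne
  · have hp0 : p = 0 := by
      funext x
      have : ¬ 0 < p x := fun h => by
        have hx : x ∈ Finset.univ.filter fun x => 0 < p x := by simpa using h
        simp [he] at hx
      exact le_antisymm (not_lt.1 this) (h0 x)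
    exact ⟨0, subset_convexHull ℝ _ ⟨∅, by simp, (Set.indicator_empty' 1).symm⟩,
      by rw [hp0]; exact smul_zero c⟩
  · obtain ⟨z, hz, hmin⟩ := Finset.exists_min_image _ p hne
    have hz0 : 0 < p z := (Finset.mem_filter.1 hz).2
    have hzm : ∀ x, 0 < p x → p z ≤ p x := fun x hx => hmin x (by simpa using hx)
    set F : Set P := {x | 0 < p x} with hF
    have hq : ∀ x, (p - p z • F.indicator 1 : P → ℝ) x = if 0 < p x then p x - p z else 0 := by
      intro x
      by_cases hx : 0 < p x
      · simp [hF, hx]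
      · simp [hF, le_antisymm (not_lt.1 hx) (h0 x)]
    have hrest := ih _ ?_ (p - p z • F.indicator 1) (c - p z) ?_ ?_ ?_ rfl
    · have hsum := Set.add_mem_add (Set.smul_mem_smul_set (a := p z)
        (subset_convexHull ℝ {q : P → ℝ | ∃ F : Set P,
          (∀ x ∈ F, ∀ y, x ≤ y → y ∈ F) ∧ q = Set.indicator F 1}
          ⟨F, fun x hx y hxy => lt_of_lt_of_le hx (hp x y hxy), rfl⟩)) hrest
      rw [← (convex_convexHull ℝ _).add_smul hz0.le (sub_nonneg.2 (h1 z))] at hsum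
      simpa using hsum
    · rw [← hn]
      refine Finset.card_lt_card (Finset.ssubset_iff_subset_ne.2 ⟨fun x hx => ?_, fun h => ?_⟩)
      · simp only [Finset.mem_filter, Finset.mem_univ, true_and, hq] at hx ⊢
        by_contra h
        simp [h] at hx
      · rw [← h] at hz
        simp [hq] at hz
    · intro x
      rw [hq]
      split_ifs with h
      · linarith [hzm x h]
      · exact le_rfl
    · intro x
      rw [hq]
      split_ifs <;> linarith [h1 x, h1 z]
    · intro x y hxy
      rw [hq, hq]
      have := hp x y hxy
      split_ifs with hx hy hy
      · linarith
      · linarith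
      · linarith [hzm y hy]
      · exact le_rfl

/-- The order polytope of a poset is convex. -/
theorem convex_orderPolytope (P : Type*) [PartialOrder P] : Convex ℝ (orderPolytope P) := by
  rintro p ⟨hp, hp'⟩ q ⟨hq, hq'⟩ a b ha hb hab
  simp only [orderPolytope, Set.mem_ofPred_eq, Pi.add_apply, Pi.smul_apply, smul_eq_mul]
  refine ⟨fun x => ⟨?_, ?_⟩, fun x y hxy => ?_⟩
  · exact add_nonneg (mul_nonneg ha (hp x).1) (mul_nonneg hb (hq x).1)
  · nlinarith [mul_le_mul_of_nonneg_left (hp x).2 ha, mul_le_mul_of_nonneg_left (hq x).2 hb]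
  · exact add_le_add (mul_le_mul_of_nonneg_left (hp' x y hxy) ha)
      (mul_le_mul_of_nonneg_left (hq' x y hxy) hb)

/-- The order polytope of a finite poset equals the convex hull of the indicator
vectors of filters (upward-closed subsets). -/
theorem orderPolytope_eq_convexHull_filters
    {P : Type*} [PartialOrder P] [Fintype P] :
    orderPolytope P =
      convexHull ℝ {q : P → ℝ | ∃ F : Set P,
        (∀ x ∈ F, ∀ y, x ≤ y → y ∈ F) ∧ q = Set.indicator F 1} := by
  refine Set.Subset.antisymm (fun p hp => ?_) (convexHull_min ?_ (convex_orderPolytope P))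
  · obtain ⟨q, hq, rfl⟩ := mem_smul_convexHull_filters p 1 (fun x => (hp.1 x).1)
      (fun x => (hp.1 x).2) hp.2
    simpa using hq
  · rintro _ ⟨F, hF, rfl⟩
    refine ⟨fun x => ?_, fun x y hxy => ?_⟩
    · by_cases hx : x ∈ F <;> simp [hx]
    · by_cases hx : x ∈ F
      · simp [hx, hF x hx y hxy]
      · by_cases hy : y ∈ F <;> simp [hx, hy]
end

section
/- For a finite poset P with n elements, the normalized volume of the order polytope O_P is equal to the number of linear extensions of P: that is, n! times the Lebesgue volume of O_P ⊆ ℝ^P equals the number of bijections f : P → {1, ..., n} such that x < y in P implies f(x) < f(y). -/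
open MeasureTheory

/-- The points of the unit cube `[0, 1]^P` whose coordinates are strictly increasing along the
enumeration `f` of `P`. -/
def enumerationSimplex {P : Type*} {n : ℕ} (f : P ≃ Fin n) : Set (P → ℝ) :=
  {p | (∀ x, 0 ≤ p x ∧ p x ≤ 1) ∧ ∀ x y, f x < f y → p x < p y}

theorem enumerationSimplex_lt_iff {P : Type*} {n : ℕ} {f : P ≃ Fin n} {p : P → ℝ}
    (hp : p ∈ enumerationSimplex f) (x y : P) : p x < p y ↔ f x < f y := by
  refine ⟨fun h => ?_, hp.2 x y⟩
  by_contra! hle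
  rcases hle.lt_or_eq with hlt | heq
  · exact lt_asymm h (hp.2 y x hlt)
  · rw [f.injective heq] at h
    exact lt_irrefl _ h

theorem measurableSet_enumerationSimplex {P : Type*} [Finite P] {n : ℕ} (f : P ≃ Fin n) :
    MeasurableSet (enumerationSimplex f) := by
  have : enumerationSimplex f =
      (⋂ x, {p : P → ℝ | 0 ≤ p x} ∩ {p | p x ≤ 1}) ∩
        ⋂ x, ⋂ y, ⋂ (_ : f x < f y), {p : P → ℝ | p x < p y} := by
    ext p
    simp [enumerationSimplex]
  rw [this]
  have := Finite.to_countable (α := P)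
  refine .inter (.iInter fun x => .inter ?_ ?_)
    (.iInter fun x => .iInter fun y => .iInter fun _ => ?_)
  · exact measurableSet_le measurable_const (measurable_pi_apply x)
  · exact measurableSet_le (measurable_pi_apply x) measurable_const
  · exact measurableSet_lt (measurable_pi_apply x) (measurable_pi_apply y)

theorem enumerationSimplex_disjoint {P : Type*} {n : ℕ} {f g : P ≃ Fin n} (hfg : f ≠ g) :
    Disjoint (enumerationSimplex f) (enumerationSimplex g) := by
  rw [Set.disjoint_left]
  intro p hf hg
  apply hfg
  have hlt (x y : P) : f x < f y ↔ g x < g y :=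
    (enumerationSimplex_lt_iff hf x y).symm.trans (enumerationSimplex_lt_iff hg x y)
  let e : Fin n ≃o Fin n :=
    { f.symm.trans g with
      map_rel_iff' := by
        intro a b
        have := hlt (f.symm b) (f.symm a)
        simp only [Equiv.apply_symm_apply] at this
        simpa using (not_congr this).symm }
  ext x
  have : e (f x) = f x := by rw [Subsingleton.elim e (OrderIso.refl _)]; rfl
  rw [← this]
  simp [e]

theorem exists_mem_enumerationSimplex {P : Type*} [Fintype P] {n : ℕ} (hn : Fintype.card P = n)
    {p : P → ℝ} (hp : Function.Injective p) (hcube : ∀ x, 0 ≤ p x ∧ p x ≤ 1) :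
    ∃ f : P ≃ Fin n, p ∈ enumerationSimplex f := by
  let := LinearOrder.lift' p hp
  let e : Fin n ≃o P := Fintype.orderIsoFinOfCardEq P hn
  refine ⟨e.symm.toEquiv, hcube, fun x y h => ?_⟩
  have : x < y := e.symm.lt_iff_lt.1 h
  exact this

theorem volume_enumerationSimplex_eq {P : Type*} [Fintype P] {n : ℕ} (f g : P ≃ Fin n) :
    volume (enumerationSimplex f) = volume (enumerationSimplex g) := by
  have h := volume_measurePreserving_piCongrLeft (fun _ : P => ℝ) (f.trans g.symm)
  rw [← h.measure_preimage (measurableSet_enumerationSimplex g).nullMeasurableSet]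
  congr 1
  ext p
  have hval (x : P) : MeasurableEquiv.piCongrLeft (fun _ : P => ℝ) (f.trans g.symm) p x =
      p (f.symm (g x)) := by
    obtain ⟨y, rfl⟩ := (f.trans g.symm).surjective x
    rw [MeasurableEquiv.coe_piCongrLeft, Equiv.piCongrLeft_apply_apply]
    simp
  simp only [enumerationSimplex, Set.mem_preimage, Set.mem_ofPred_eq, hval]
  refine and_congr ⟨fun h x => h _, fun h x => ?_⟩ ⟨fun h x y hxy => ?_, fun h x y hxy => ?_⟩
  · simpa using h (g.symm (f x))
  · exact h _ _ (by simpa using hxy)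
  · simpa using h (g.symm (f x)) (g.symm (f y)) (by simpa using hxy)

theorem ae_injective {P : Type*} [Fintype P] :
    ∀ᵐ p : P → ℝ, Function.Injective p := by
  classical
  have h (x y : P) (hxy : x ≠ y) : ∀ᵐ p : P → ℝ, p x ≠ p y := by
    let L : (P → ℝ) →ₗ[ℝ] ℝ :=
      LinearMap.proj (R := ℝ) (φ := fun _ : P => ℝ) x -
        LinearMap.proj (R := ℝ) (φ := fun _ : P => ℝ) y
    have hL : LinearMap.ker L ≠ ⊤ := by
      intro htop
      have : Pi.single x (1 : ℝ) ∈ LinearMap.ker L := htop ▸ Submodule.mem_top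
      simp [L, hxy.symm] at this
    refine measure_mono_null (fun p hp => ?_) (Measure.addHaar_submodule volume _ hL)
    simpa [L, sub_eq_zero] using hp
  have h' : ∀ᵐ p : P → ℝ, ∀ x y, x ≠ y → p x ≠ p y := by
    simp only [ae_all_iff]
    exact h
  filter_upwards [h'] with p hp x y hxy
  exact by_contra fun hne => hp x y hne hxy

theorem volume_eq_card_mul_volume_enumerationSimplex {P : Type*} [Fintype P] {n : ℕ}
    (hn : Fintype.card P = n) (g : P ≃ Fin n) {C : Set (P → ℝ)} {A : (P ≃ Fin n) → Prop}
    (hcube : ∀ p ∈ C, ∀ x, 0 ≤ p x ∧ p x ≤ 1)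
    (hCA : ∀ f, ∀ p ∈ enumerationSimplex f, p ∈ C ↔ A f) :
    volume C = (Nat.card {f // A f} : ENNReal) * volume (enumerationSimplex g) := by
  classical
  have hC : C =ᵐ[volume] ⋃ f : {f // A f}, enumerationSimplex f.1 := by
    filter_upwards [ae_injective] with p hp
    refine propext ⟨fun h => ?_, fun h => ?_⟩
    · obtain ⟨f, hf⟩ := exists_mem_enumerationSimplex hn hp (hcube p h)
      exact Set.mem_iUnion.2 ⟨⟨f, (hCA f p hf).1 h⟩, hf⟩
    · obtain ⟨f, hf⟩ := Set.mem_iUnion.1 h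
      exact (hCA f p hf).2 f.2
  rw [measure_congr hC, measure_iUnion
    (fun f f' hff' => enumerationSimplex_disjoint (Subtype.coe_injective.ne hff'))
    (fun f => measurableSet_enumerationSimplex f.1), tsum_fintype,
    Finset.sum_congr rfl fun f _ => volume_enumerationSimplex_eq f.1 g]
  simp [Nat.card_eq_fintype_card]

theorem factorial_mul_volume_enumerationSimplex {P : Type*} [Fintype P] {n : ℕ}
    (hn : Fintype.card P = n) (g : P ≃ Fin n) :
    (n.factorial : ENNReal) * volume (enumerationSimplex g) = 1 := by
  classical
  have h := volume_eq_card_mul_volume_enumerationSimplex hn g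
    (C := Set.Icc (0 : P → ℝ) 1) (A := fun _ => True)
    (fun p hp x => ⟨hp.1 x, hp.2 x⟩)
    (fun f p hp => iff_true_intro ⟨fun x => (hp.1 x).1, fun x => (hp.1 x).2⟩)
  have hcard : Nat.card {_f : P ≃ Fin n // True} = n.factorial := by
    rw [Nat.card_congr (Equiv.subtypeUnivEquiv fun _ => trivial), Nat.card_eq_fintype_card,
      Fintype.card_equiv g, hn]
  rw [hcard] at h
  rw [← h, Real.volume_Icc_pi]
  simp

/-- The normalized volume (`n!` times the Lebesgue volume) of the order polytope of a
finite poset `P` with `n` elements equals the number of linear extensions of `P`, i.e.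
the number of bijections `f : P → {1, …, n}` with `x < y → f x < f y`. -/
theorem normalized_volume_orderPolytope_eq_card_linearExtensions
    {P : Type*} [PartialOrder P] [Fintype P] (n : ℕ) (hn : Fintype.card P = n) :
    (Nat.factorial n : ENNReal) * MeasureTheory.volume (orderPolytope P) =
      (Nat.card {f : P ≃ Fin n // ∀ x y : P, x < y → f x < f y} : ENNReal) := by
  let g : P ≃ Fin n := Fintype.equivFinOfCardEq hn
  rw [volume_eq_card_mul_volume_enumerationSimplex hn g (C := orderPolytope P)
    (A := fun f => ∀ x y : P, x < y → f x < f y) (fun p hp => hp.1) ?_, mul_left_comm,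
    factorial_mul_volume_enumerationSimplex hn g, mul_one]
  refine fun f p hp => ⟨fun h x y hxy => ?_, fun h => ⟨hp.1, fun x y hxy => ?_⟩⟩
  · have hle : f x ≤ f y := not_lt.1 fun hlt => (hp.2 y x hlt).not_ge (h.2 x y hxy.le)
    exact hle.lt_of_ne (f.injective.ne hxy.ne)
  · rcases hxy.lt_or_eq with hlt | rfl
    · exact (hp.2 x y (h x y hlt)).le
    · exact le_rfl
end

section
/- For a finite poset P, the order polytope O_P satisfies the integer decomposition property: for every positive integer m and every point q of the dilation m·O_P all of whose coordinates are integers, there exist filters F_1, ..., F_m of P (not necessarily distinct) such that q = 1_{F_1} + ... + 1_{F_m}. In particular, every lattice point of m·O_P is a sum of m vertices of O_P. -/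
/-- The integers `0, …, m - 1` below `n ≤ m` are `n` in number. -/
theorem sum_fin_ite_lt {m n : ℕ} (h : n ≤ m) :
    ∑ i : Fin m, (if (i : ℕ) < n then (1 : ℝ) else 0) = n := by
  rw [Fin.sum_univ_eq_sum_range (fun i => if i < n then (1 : ℝ) else 0) m, Finset.sum_boole]
  have : (Finset.range m).filter (· < n) = Finset.range n := by
    ext i
    simp only [Finset.mem_filter, Finset.mem_range]
    omega
  rw [this, Finset.card_range]

/-- The order polytope of a finite poset satisfies the integer decomposition property:
every lattice point of the `m`-th dilation is a sum of `m` indicator vectors of filters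
(i.e. a sum of `m` vertices of the order polytope). -/
theorem orderPolytope_integerDecomposition
    {P : Type*} [PartialOrder P] [Fintype P] (m : ℕ) (hm : 0 < m) (q : P → ℝ)
    (hq : q ∈ (fun p : P → ℝ => (m : ℝ) • p) '' orderPolytope P)
    (hint : ∀ x, ∃ z : ℤ, q x = (z : ℝ)) :
    ∃ F : Fin m → Set P,
      (∀ i, ∀ x ∈ F i, ∀ y, x ≤ y → y ∈ F i) ∧
      q = ∑ i, Set.indicator (F i) (1 : P → ℝ) := by
  obtain ⟨p, ⟨hp, hmono⟩, rfl⟩ := hq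
  refine ⟨fun i => {x | ((i : ℕ) : ℝ) < ((m : ℝ) • p) x}, ?_, ?_⟩
  · intro i x hx y hxy
    exact lt_of_lt_of_le hx (mul_le_mul_of_nonneg_left (hmono x y hxy) m.cast_nonneg)
  · funext x
    obtain ⟨z, hz⟩ := hint x
    change ((m : ℝ) • p) x = (z : ℝ) at hz
    have hz0 : 0 ≤ z := by
      have h : (0 : ℝ) ≤ ((m : ℝ) • p) x := mul_nonneg m.cast_nonneg (hp x).1
      rw [hz] at h
      exact_mod_cast h
    lift z to ℕ using hz0
    have hzm : z ≤ m := by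
      have h : ((m : ℝ) • p) x ≤ m := mul_le_of_le_one_right m.cast_nonneg (hp x).2
      rw [hz] at h
      exact_mod_cast h
    rw [Finset.sum_apply]
    simp only [Set.indicator_apply, Set.mem_ofPred_eq, hz, Pi.one_apply, Int.cast_natCast,
      Nat.cast_lt]
    exact (sum_fin_ite_lt hzm).symm
end
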